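/- arXiv:1310.4743 — 2 statements merged into one kernel-verified Lean document; each statement's English description precedes it below -/
import Mathlib

section
/- Desubstitution of abelian squares in the ternary Thue–Morse word: let u, v be nonempty abelian equivalent words over {0,1,2} such that u·v is a factor of x = g^ω(0) (i.e. a contiguous subword of g^n(0) for some n). Then there exist words u', v' over {0,1,2} such that u'·v' is a factor of x and either (1) g(u') = u and g(v') = v, or (2) g(v') = reverse(u) and g(u') = reverse(v). -/
/-- The morphism g : 0 ↦ 012, 1 ↦ 02, 2 ↦ 1. -/
def g : Fin 3 → List (Fin 3) := ![[0,1,2],[0,2],[1]]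

/-- Apply the morphism g to a word. -/
def gWord (w : List (Fin 3)) : List (Fin 3) := w.flatMap g

/-- The prefix g^n(0) of the ternary Thue–Morse word. -/
def gPow (n : ℕ) : List (Fin 3) := gWord^[n] [0]

@[simp] theorem gWord_nil : gWord [] = [] := rfl

@[simp] theorem gWord_append (a b : List (Fin 3)) : gWord (a ++ b) = gWord a ++ gWord b :=
  List.flatMap_append

@[simp] theorem gWord_zero_cons (w : List (Fin 3)) : gWord (0 :: w) = 0 :: 1 :: 2 :: gWord w := rfl

@[simp] theorem gWord_one_cons (w : List (Fin 3)) : gWord (1 :: w) = 0 :: 2 :: gWord w := rfl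

@[simp] theorem gWord_two_cons (w : List (Fin 3)) : gWord (2 :: w) = 1 :: gWord w := rfl

theorem gWord_ne_nil {w : List (Fin 3)} (h : w ≠ []) : gWord w ≠ [] := by
  cases w with
  | nil => exact absurd rfl h
  | cons c w => fin_cases c <;> simp

theorem gPow_succ (n : ℕ) : gPow (n + 1) = gWord (gPow n) :=
  Function.iterate_succ_apply' _ _ _

theorem gPow_succ_eq_append (n : ℕ) : ∃ s, s ≠ [] ∧ gPow (n + 1) = gPow n ++ s := by
  induction n with
  | zero => exact ⟨[1, 2], by simp, rfl⟩
  | succ n ih =>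
    obtain ⟨s, hs, h⟩ := ih
    exact ⟨gWord s, gWord_ne_nil hs, by
      rw [gPow_succ (n + 1), congrArg gWord h, gWord_append, ← gPow_succ]⟩

theorem gPow_prefix_of_le {m n : ℕ} (h : m ≤ n) : gPow m <+: gPow n := by
  induction n, h using Nat.le_induction with
  | base => exact List.prefix_rfl
  | succ n _ ih =>
    obtain ⟨s, -, hs⟩ := gPow_succ_eq_append n
    exact ih.trans (hs ▸ List.prefix_append _ _)

theorem count_zero_gWord (w : List (Fin 3)) : (gWord w).count 0 = (gWord w).count 2 := by
  induction w with
  | nil => rfl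
  | cons c w ih => fin_cases c <;> simp [ih]

/-- In `g(w)` the letters 0 and 2 alternate, starting with 0. -/
theorem count_of_prefix_gWord (w a b : List (Fin 3)) (h : gWord w = a ++ b) :
    a.count 0 = a.count 2 ∨ a.count 0 = a.count 2 + 1 := by
  induction w generalizing a with
  | nil => simp_all
  | cons c w ih =>
    fin_cases c <;> simp [List.cons_eq_append_iff] at h <;>
      grind

/-- The balanced prefixes of `g(w)` are the images of the prefixes of `w`. -/
theorem exists_split_of_gWord_eq_append (w a b : List (Fin 3)) (h : gWord w = a ++ b)
    (ha : a.count 0 = a.count 2) : ∃ w₁ w₂, w = w₁ ++ w₂ ∧ gWord w₁ = a ∧ gWord w₂ = b := by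
  induction w generalizing a with
  | nil =>
    simp only [gWord_nil, List.nil_eq, List.append_eq_nil_iff] at h
    exact ⟨[], [], rfl, h.1.symm, h.2.symm⟩
  | cons c w ih =>
    by_cases hn : a = []
    · exact ⟨[], c :: w, rfl, hn.symm, by simpa [hn] using h⟩
    · obtain ⟨a', rfl, h'⟩ : ∃ a', a = gWord [c] ++ a' ∧ gWord w = a' ++ b := by
        fin_cases c <;> simp [List.cons_eq_append_iff] at h ⊢ <;>
          grind
      have ha' : a'.count 0 = a'.count 2 := by
        have := count_zero_gWord [c]
        simp only [List.count_append] at ha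
        omega
      obtain ⟨w₁, w₂, rfl, rfl, rfl⟩ := ih a' h' ha'
      exact ⟨c :: w₁, w₂, rfl, gWord_append [c] w₁, rfl⟩

theorem exists_split_of_balanced {n : ℕ} {a u v b : List (Fin 3)}
    (h : gPow (n + 1) = a ++ (u ++ (v ++ b))) (ha : a.count 0 = a.count 2)
    (hu : u.count 0 = u.count 2) (hv : v.count 0 = v.count 2) :
    ∃ u' v', (∃ m, (u' ++ v') <:+: gPow m) ∧ gWord u' = u ∧ gWord v' = v := by
  rw [gPow_succ] at h
  obtain ⟨w₀, w₁, hw, -, h₁⟩ := exists_split_of_gWord_eq_append _ _ _ h ha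
  obtain ⟨u', w₂, rfl, hu', h₂⟩ := exists_split_of_gWord_eq_append _ _ _ h₁ hu
  obtain ⟨v', w₃, rfl, hv', -⟩ := exists_split_of_gWord_eq_append _ _ _ h₂ hv
  exact ⟨u', v', ⟨n, w₀, w₃, by simp [hw]⟩, hu', hv'⟩

/-- `g²` and its mirror image are conjugated by the letter 0. -/
theorem gWord_gWord_reverse (w : List (Fin 3)) :
    gWord (gWord w.reverse) ++ [0] = 0 :: (gWord (gWord w)).reverse := by
  induction w with
  | nil => rfl
  | cons c w ih =>
    have hc : gWord (gWord [c]) ++ [0] = [0] ++ (gWord (gWord [c])).reverse := by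
      fin_cases c <;> rfl
    rw [List.reverse_cons, gWord_append, gWord_append, List.append_assoc, hc,
      ← List.append_assoc, ih, ← List.singleton_append (l := w), gWord_append, gWord_append,
      List.reverse_append, List.cons_append]

theorem exists_gPow_eq_append_reverse {w : List (Fin 3)} (h : ∃ m, w.reverse <:+: gPow m) :
    ∃ m p q, gPow (m + 1) = p ++ (gWord (gWord w)).reverse ++ q ∧
      p.count 0 = p.count 2 + 1 := by
  obtain ⟨m, a, b, hm⟩ := h
  obtain ⟨s, hs, hms⟩ := gPow_succ_eq_append m
  obtain ⟨c, r, hcr⟩ := List.exists_cons_of_ne_nil (List.append_ne_nil_of_right_ne_nil b hs)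
  obtain ⟨r', hr'⟩ : ∃ r', gWord (gWord (c :: r)) = [0] ++ r' := by
    fin_cases c <;> simp
  refine ⟨m + 2, gWord (gWord a) ++ [0], r', ?_, ?_⟩
  · rw [gPow_succ, gPow_succ, hms, ← hm, List.append_assoc _ b, hcr, gWord_append, gWord_append,
      hr', gWord_append, gWord_append, ← List.append_assoc, List.append_assoc _ _ [0],
      gWord_gWord_reverse]
    simp
  · simp [List.count_append, count_zero_gWord]

theorem reverse_gPow_infix (n : ℕ) : ∃ m, (gPow (2 * n)).reverse <:+: gPow m := by
  induction n with
  | zero => exact ⟨0, List.infix_rfl⟩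
  | succ n ih =>
    obtain ⟨m, p, q, h, -⟩ := exists_gPow_eq_append_reverse ih
    exact ⟨m + 1, p, q, by rw [h, mul_add, ← gPow_succ, ← gPow_succ]⟩

/-- Desubstitution of abelian squares in the ternary Thue–Morse word. -/
theorem desubstitution_of_abelian_squares
    (u v : List (Fin 3)) (hu : u ≠ []) (hv : v ≠ [])
    (hab : ∀ a : Fin 3, u.count a = v.count a)
    (hfac : ∃ n : ℕ, (u ++ v) <:+: gPow n) :
    ∃ u' v' : List (Fin 3), (∃ m : ℕ, (u' ++ v') <:+: gPow m) ∧
      ((gWord u' = u ∧ gWord v' = v) ∨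
       (gWord v' = u.reverse ∧ gWord u' = v.reverse)) := by
  obtain ⟨n, hn⟩ := hfac
  obtain ⟨a, b, h⟩ := hn.trans
    (gPow_prefix_of_le (show n ≤ 2 * n + 1 + 1 by omega)).isInfix
  simp only [List.append_assoc] at h
  have hg := h.trans (gPow_succ _)
  have h₀ := count_of_prefix_gWord _ a _ hg.symm
  have h₁ := count_of_prefix_gWord _ (a ++ u) (v ++ b) (by simpa using hg.symm)
  have h₂ := count_of_prefix_gWord _ (a ++ (u ++ v)) b (by simpa using hg.symm)
  simp only [List.count_append] at h₁ h₂
  have hab₀ := hab 0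
  have hab₂ := hab 2
  have hub : u.count 0 = u.count 2 := by omega
  have hvb : v.count 0 = v.count 2 := by omega
  rcases h₀ with h₀ | h₀
  · obtain ⟨u', v', hf, hu', hv'⟩ := exists_split_of_balanced h.symm h₀ hub hvb
    exact ⟨u', v', hf, Or.inl ⟨hu', hv'⟩⟩
  · obtain ⟨m, p, q, hm, hp⟩ := exists_gPow_eq_append_reverse (reverse_gPow_infix n)
    rw [← gPow_succ, ← gPow_succ, ← h] at hm
    have hb := count_zero_gWord (gPow (2 * n + 1))
    rw [← hg] at hb
    simp only [List.count_append] at hb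
    obtain ⟨u', v', hf, hu', hv'⟩ := exists_split_of_balanced (n := m) (a := p ++ b.reverse)
      (u := v.reverse) (v := u.reverse) (b := a.reverse ++ q) (by simpa using hm)
      (by simp only [List.count_append, List.count_reverse]; omega)
      (by simpa using hvb) (by simpa using hub)
    exact ⟨u', v', hf, Or.inr ⟨hv', hu'⟩⟩
end

section
/- For every word u over {0,1}, the extended Parikh vector of h(u) equals M_h times the extended Parikh vector of u; explicitly: |h(u)|_0 = 2|u|_0 + |u|_1; |h(u)|_1 = |u|_0 + 2|u|_1; C(h(u),00) = |u|_0 + 4C(u,00) + 2C(u,01) + 2C(u,10) + C(u,11); C(h(u),01) = 2|u|_0 + 2|u|_1 + 2C(u,00) + 4C(u,01) + C(u,10) + 2C(u,11); C(h(u),10) = 2C(u,00) + C(u,01) + 4C(u,10) + 2C(u,11); C(h(u),11) = |u|_1 + C(u,00) + 2C(u,01) + 2C(u,10) + 4C(u,11). -/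
/-- Number of occurrences of `v` as a scattered subword (subsequence) of `u`. -/
def binomC {α : Type*} [DecidableEq α] (u v : List α) : ℕ := u.sublists.count v

/-- Two words are 2-binomially equivalent. -/
def binEq2 {α : Type*} [DecidableEq α] (u v : List α) : Prop :=
  ∀ x : List α, x.length ≤ 2 → binomC u x = binomC v x

/-- The morphism h : 0 ↦ 001, 1 ↦ 011. -/
def h : Fin 2 → List (Fin 2) := ![[0,0,1],[0,1,1]]

/-- Apply the morphism h to a word. -/
def hWord (w : List (Fin 2)) : List (Fin 2) := w.flatMap h

theorem binomC_nil_right {α : Type*} [DecidableEq α] (u : List α) : binomC u [] = 1 := by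
  rw [binomC, (List.sublists_perm_sublists' u).count_eq]
  induction u with
  | nil => simp
  | cons a u ih =>
    rw [List.sublists'_cons, List.count_append, ih, Nat.add_eq_left]
    exact List.count_eq_zero.2 (by simp)

theorem binomC_nil_cons {α : Type*} [DecidableEq α] (b : α) (v : List α) :
    binomC [] (b :: v) = 0 := by
  simp [binomC]

theorem binomC_cons_cons {α : Type*} [DecidableEq α] (a b : α) (u v : List α) :
    binomC (a :: u) (b :: v) = binomC u (b :: v) + if a = b then binomC u v else 0 := by
  simp only [binomC, (List.sublists_perm_sublists' _).count_eq, List.sublists'_cons,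
    List.count_append]
  congr 1
  split_ifs with hab
  · subst hab
    exact List.count_map_of_injective _ _ (List.cons_injective) _
  · exact List.count_eq_zero.2 (by simp [hab])

theorem binomC_singleton {α : Type*} [DecidableEq α] (u : List α) (a : α) :
    binomC u [a] = u.count a := by
  induction u with
  | nil => simp [binomC_nil_cons]
  | cons b u ih => simp [binomC_cons_cons, binomC_nil_right, ih, List.count_cons]

theorem hWord_cons_zero (u : List (Fin 2)) : hWord (0 :: u) = 0 :: 0 :: 1 :: hWord u := rfl

theorem hWord_cons_one (u : List (Fin 2)) : hWord (1 :: u) = 0 :: 1 :: 1 :: hWord u := rfl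

/-- The extended Parikh vector of h(u) is M_h times the extended Parikh vector of u. -/
theorem extended_parikh_of_h (u : List (Fin 2)) :
    (hWord u).count 0 = 2 * u.count 0 + u.count 1 ∧
    (hWord u).count 1 = u.count 0 + 2 * u.count 1 ∧
    binomC (hWord u) [0,0] =
      u.count 0 + 4 * binomC u [0,0] + 2 * binomC u [0,1]
        + 2 * binomC u [1,0] + binomC u [1,1] ∧
    binomC (hWord u) [0,1] =
      2 * u.count 0 + 2 * u.count 1 + 2 * binomC u [0,0] + 4 * binomC u [0,1]
        + binomC u [1,0] + 2 * binomC u [1,1] ∧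
    binomC (hWord u) [1,0] =
      2 * binomC u [0,0] + binomC u [0,1] + 4 * binomC u [1,0]
        + 2 * binomC u [1,1] ∧
    binomC (hWord u) [1,1] =
      u.count 1 + binomC u [0,0] + 2 * binomC u [0,1] + 2 * binomC u [1,0]
        + 4 * binomC u [1,1] := by
  induction u with
  | nil => simp [hWord, binomC_nil_cons]
  | cons a u ih =>
    obtain ⟨h0, h1, h00, h01, h10, h11⟩ := ih
    obtain rfl | rfl : a = 0 ∨ a = 1 := by omega
    all_goals
      simp only [hWord_cons_zero, hWord_cons_one, binomC_cons_cons, binomC_singleton,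
        List.count_cons, h0, h1, h00, h01, h10, h11]
      simp
      omega
end
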